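/- arXiv:2511.19247 — 6 statements merged into one kernel-verified Lean document; each statement's English description precedes it below -/
import Mathlib

section
/- Let n₁, n₂, p ≥ 1 and let S_i ∈ 𝕊_p(ℝ) for i ∈ {−2n₁,…,2n₂}. Then the following are equivalent: (1) there exists a finitely atomic representing measure for (S_i): pairwise distinct nonzero reals x_1,…,x_ℓ and nonzero psd matrices A_1,…,A_ℓ ∈ 𝕊_p(ℝ) with S_i = Σ_{j=1}^ℓ x_j^i A_j for all i ∈ {−2n₁,…,2n₂}; (2) there exists such a representation which is minimal, i.e., Σ_{j=1}^ℓ rank A_j = rank (S_{i+j})_{i,j=−n₁}^{n₂}; (3) (S_{i+j})_{i,j=−n₁}^{n₂} is positive semidefinite and Ker (S_{i+j})_{i,j=−n₁}^{n₂−1} = Ker (S_{i+j})_{i,j=−n₁+1}^{n₂}; (4) (S_{i+j})_{i,j=−n₁}^{n₂} is positive semidefinite and for every family v_0,…,v_{n₁+n₂−1} ∈ ℝ^p one has Σ_{i,j=−n₁}^{n₂−1} v_{j+n₁}ᵀ S_{i+j} v_{i+n₁} = 0 if and only if Σ_{i,j=−n₁}^{n₂−1} v_{j+n₁}ᵀ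 S_{i+j+2} v_{i+n₁} = 0. -/
open Finset Matrix

/-- A finitely atomic representing measure for the strong (two-sided) truncated matrix
moment problem: pairwise distinct *nonzero* atoms `x j` with nonzero psd masses `A j`
such that `S i = ∑ j (x j)^i • A j` for all `i ∈ {-2n₁, …, 2n₂}` (integer powers). -/
def IsStrongRepMeasure (n₁ n₂ p : ℕ) (S : ℤ → Matrix (Fin p) (Fin p) ℝ) (ℓ : ℕ)
    (x : Fin ℓ → ℝ) (A : Fin ℓ → Matrix (Fin p) (Fin p) ℝ) : Prop :=
  Function.Injective x ∧ (∀ j, x j ≠ 0) ∧ (∀ j, (A j).PosSemidef) ∧ (∀ j, A j ≠ 0) ∧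
    ∀ i : ℤ, -(2 * (n₁ : ℤ)) ≤ i → i ≤ 2 * (n₂ : ℤ) → S i = ∑ j, x j ^ i • A j

/-- The full block Hankel matrix `(S_{i+j})_{i,j=-n₁}^{n₂}` of size `(n₁+n₂+1)p`. -/
def strongHankel (n₁ n₂ p : ℕ) (S : ℤ → Matrix (Fin p) (Fin p) ℝ) :
    Matrix (Fin (n₁ + n₂ + 1) × Fin p) (Fin (n₁ + n₂ + 1) × Fin p) ℝ :=
  fun ia jb => S ((ia.1.1 : ℤ) + (jb.1.1 : ℤ) - 2 * (n₁ : ℤ)) ia.2 jb.2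

/-- The block Hankel matrix `(S_{i+j+c})_{i,j=-n₁}^{n₂-1}` of size `(n₁+n₂)p`,
with an integer shift `c` (take `c = 0` resp. `c = 2` for the two kernels). -/
def strongHankelSub (n₁ n₂ p : ℕ) (c : ℤ) (S : ℤ → Matrix (Fin p) (Fin p) ℝ) :
    Matrix (Fin (n₁ + n₂) × Fin p) (Fin (n₁ + n₂) × Fin p) ℝ :=
  fun ia jb => S ((ia.1.1 : ℤ) + (jb.1.1 : ℤ) - 2 * (n₁ : ℤ) + c) ia.2 jb.2


/-- Rank is subadditive over finite sums of matrices. -/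
theorem Matrix.rank_finset_sum_le {κ m n : Type*} [Fintype m] [Fintype n] (s : Finset κ)
    (M : κ → Matrix m n ℝ) : (∑ k ∈ s, M k).rank ≤ ∑ k ∈ s, (M k).rank := by
  classical
  induction s using Finset.induction_on with
  | empty => simp
  | insert a s ha ih =>
    rw [Finset.sum_insert ha, Finset.sum_insert ha]
    refine le_trans ?_ (Nat.add_le_add_left ih _)
    unfold Matrix.rank
    rw [Matrix.mulVecLin_add]
    exact (Submodule.finrank_mono (LinearMap.range_add_le _ _)).trans
      (Submodule.finrank_add_le_finrank_add_finrank _ _)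

open scoped MatrixOrder in
/-- A positive semidefinite matrix is the Gram matrix of vectors in a Euclidean space whose
dimension is the rank of the matrix. -/
theorem Matrix.PosSemidef.exists_gram {ι : Type*} [Fintype ι] {H : Matrix ι ι ℝ}
    (hH : H.PosSemidef) :
    ∃ g : ι → EuclideanSpace ℝ (Fin H.rank), ∀ a b, inner ℝ (g a) (g b) = H a b := by
  classical
  obtain ⟨B, hB⟩ : ∃ B : Matrix ι ι ℝ, H = Bᴴ * B := by
    exact CStarAlgebra.nonneg_iff_eq_star_mul_self.mp hH.nonneg
  let f : (ι → ℝ) ≃ₗ[ℝ] EuclideanSpace ℝ ι := (WithLp.linearEquiv 2 ℝ (ι → ℝ)).symm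
  let E : Submodule ℝ (EuclideanSpace ℝ ι) :=
    (Submodule.span ℝ (Set.range B.col)).map f.toLinearMap
  have hE : Module.finrank ℝ E = H.rank := by
    rw [hB, Matrix.rank_conjTranspose_mul_self, Matrix.rank_eq_finrank_span_cols]
    exact LinearEquiv.finrank_map_eq f _
  let b := (stdOrthonormalBasis ℝ E).reindex (finCongr hE)
  have hmem (a : ι) : f (B.col a) ∈ E :=
    Submodule.mem_map_of_mem (Submodule.subset_span ⟨a, rfl⟩)
  refine ⟨fun a => b.repr ⟨f (B.col a), hmem a⟩, fun a c => ?_⟩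
  rw [LinearIsometryEquiv.inner_map_map, Submodule.coe_inner, hB]
  simp [f, Matrix.mul_apply, PiLp.inner_apply, mul_comm]

/-- A symmetric partially defined injective operator on a finite-dimensional inner product space,
given as `L₀ v ↦ L₁ v`, extends to a symmetric injective operator on the whole space. -/
theorem exists_isSymmetric_injective_extension {V E : Type*} [AddCommGroup V] [Module ℝ V]
    [NormedAddCommGroup E] [InnerProductSpace ℝ E] [FiniteDimensional ℝ E]
    (L₀ L₁ : V →ₗ[ℝ] E) (hker : ∀ v, L₀ v = 0 ↔ L₁ v = 0)
    (hsymm : ∀ v w, inner ℝ (L₁ v) (L₀ w) = inner ℝ (L₀ v) (L₁ w)) :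
    ∃ M : E →ₗ[ℝ] E, M.IsSymmetric ∧ Function.Injective M ∧ ∀ v, M (L₀ v) = L₁ v := by
  obtain ⟨s, hs⟩ := L₀.rangeRestrict.exists_rightInverse_of_surjective L₀.range_rangeRestrict
  let K := LinearMap.range L₀
  let P : E →ₗ[ℝ] E := K.starProjection.toLinearMap
  have hP : P.IsSymmetric := K.starProjection_isSymmetric
  have hPmem (x : E) : P x ∈ K := K.starProjection_apply_mem x
  have hPK {x : E} (hx : x ∈ K) : P x = x := K.starProjection_eq_self_iff.2 hx
  let R : E →ₗ[ℝ] E := L₁ ∘ₗ s ∘ₗ K.orthogonalProjectionOnto.toLinearMap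
  have hR (x : E) (v : V) (hv : L₀ v = P x) : R x = L₁ v := by
    have h1 : L₀ (s (K.orthogonalProjectionOnto x)) = P x :=
      congrArg Subtype.val (LinearMap.congr_fun hs (K.orthogonalProjectionOnto x))
    have h2 := (hker (s (K.orthogonalProjectionOnto x) - v)).1 (by rw [map_sub, h1, hv, sub_self])
    rw [map_sub, sub_eq_zero] at h2
    exact h2
  have hRsymm (x y : E) : inner ℝ (R x) (P y) = inner ℝ (P x) (R y) := by
    obtain ⟨v, hv⟩ := hPmem x
    obtain ⟨w, hw⟩ := hPmem y
    rw [hR x v hv, hR y w hw, ← hv, ← hw, hsymm]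
  let M₀ : E →ₗ[ℝ] E := R + LinearMap.adjoint R - P ∘ₗ R
  have hM₀ : M₀.IsSymmetric := by
    intro x y
    simp only [M₀, LinearMap.sub_apply, LinearMap.add_apply, LinearMap.comp_apply, inner_sub_left,
      inner_sub_right, inner_add_left, inner_add_right, LinearMap.adjoint_inner_left,
      LinearMap.adjoint_inner_right, hP _ y, ← hP x, hRsymm]
    ring
  have hM₀L (v : V) : M₀ (L₀ v) = L₁ v := by
    have hv : P (L₀ v) = L₀ v := hPK ⟨v, rfl⟩
    have h1 : LinearMap.adjoint R (L₀ v) = P (R (L₀ v)) := by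
      refine ext_inner_right ℝ fun y => ?_
      rw [LinearMap.adjoint_inner_left, hP, hRsymm, hv]
    simp [M₀, h1, hR (L₀ v) v hv.symm]
  let W : Submodule ℝ E := (LinearMap.ker M₀).map (LinearMap.id - P)
  let Q : E →ₗ[ℝ] E := W.starProjection.toLinearMap
  have hQ : Q.IsSymmetric := W.starProjection_isSymmetric
  have hQmem (x : E) : Q x ∈ W := W.starProjection_apply_mem x
  have hQW {x : E} (hx : x ∈ W) : Q x = x := W.starProjection_eq_self_iff.2 hx
  have hPW {x : E} (hx : x ∈ W) : P x = 0 := by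
    obtain ⟨y, -, rfl⟩ := hx
    simp [hPK (hPmem y)]
  have hQP (x : E) : Q (P x) = 0 := by
    refine ext_inner_right ℝ fun y => ?_
    rw [hQ, hP, hPW (hQmem y), inner_zero_left, inner_zero_right]
  refine ⟨M₀ + Q, hM₀.add hQ, ?_, fun v => ?_⟩
  · rw [← LinearMap.ker_eq_bot, LinearMap.ker_eq_bot']
    intro x hx
    rw [LinearMap.add_apply] at hx
    have h1 (k : E) (hk : M₀ k = 0) : inner ℝ (Q x) k = 0 := by
      have h := congrArg (inner ℝ · k) hx
      simpa [inner_add_left, hM₀ x k, hk] using h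
    have hQx : Q x = 0 := by
      obtain ⟨k, hk, hkx⟩ := hQmem x
      have : inner ℝ (Q x) (Q x) = 0 := by
        nth_rewrite 2 [← hkx]
        simp only [LinearMap.sub_apply, LinearMap.id_apply, inner_sub_right, h1 k hk]
        rw [← hP, hPW (hQmem x), inner_zero_left, sub_zero]
      exact inner_self_eq_zero.1 this
    have hx0 : M₀ x = 0 := by simpa [hQx] using hx
    have hxP : x - P x = 0 := by
      have := hQW (x := x - P x) ⟨x, hx0, rfl⟩
      rw [← this, map_sub, hQx, hQP, sub_zero]
    obtain ⟨v, hv⟩ := hPmem x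
    rw [← sub_eq_zero.1 hxP] at hv
    rw [← hv, hM₀L] at hx0
    rw [← hv, (hker v).2 hx0]
  · have : Q (L₀ v) = 0 := by rw [← hPK (x := L₀ v) ⟨v, rfl⟩, hQP]
    rw [LinearMap.add_apply, this, add_zero, hM₀L]

section Representation

variable {n₁ n₂ p : ℕ} {S : ℤ → Matrix (Fin p) (Fin p) ℝ}

/-- A representation by rank one masses at nonzero, not necessarily distinct, atoms can be
regrouped into a representing measure whose total rank is at most the number of masses. -/
theorem exists_isStrongRepMeasure_of_sum_vecMulVec {r : ℕ} (t : Fin r → ℝ) (ht : ∀ m, t m ≠ 0)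
    (w : Fin r → Fin p → ℝ)
    (hS : ∀ i : ℤ, -(2 * (n₁ : ℤ)) ≤ i → i ≤ 2 * (n₂ : ℤ) →
      S i = ∑ m, t m ^ i • vecMulVec (w m) (w m)) :
    ∃ (ℓ : ℕ) (x : Fin ℓ → ℝ) (A : Fin ℓ → Matrix (Fin p) (Fin p) ℝ),
      IsStrongRepMeasure n₁ n₂ p S ℓ x A ∧ ∑ j, (A j).rank ≤ r := by
  classical
  let s : Finset (Fin r) := univ.filter fun m => w m ≠ 0
  let X : Finset ℝ := s.image t
  let mass (y : ℝ) : Matrix (Fin p) (Fin p) ℝ :=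
    ∑ m ∈ s with t m = y, vecMulVec (w m) (w m)
  have hpsd (m : Fin r) : (vecMulVec (w m) (w m)).PosSemidef := by
    simpa using posSemidef_vecMulVec_self_star (w m)
  have hX {M : Type} [AddCommMonoid M] (f : ℝ → M) :
      ∑ j, f (X.equivFin.symm j) = ∑ y ∈ X, f y := by
    rw [Equiv.sum_comp X.equivFin.symm (fun y : X => f y), Finset.sum_coe_sort]
  have hmaps : ∀ m ∈ s, t m ∈ X := fun m hm => Finset.mem_image_of_mem t hm
  refine ⟨X.card, fun j => X.equivFin.symm j, fun j => mass (X.equivFin.symm j),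
    ⟨Subtype.val_injective.comp X.equivFin.symm.injective, fun j => ?_, fun j => ?_, fun j => ?_,
      fun i hi₁ hi₂ => ?_⟩, ?_⟩
  · obtain ⟨m, -, hm⟩ := Finset.mem_image.1 (X.equivFin.symm j).2
    exact hm.subst (motive := (· ≠ 0)) (ht m)
  · exact posSemidef_sum _ fun m _ => hpsd m
  · obtain ⟨m, hms, hm⟩ := Finset.mem_image.1 (X.equivFin.symm j).2
    intro h0
    have htr := congrArg Matrix.trace h0
    rw [Matrix.trace_sum, Matrix.trace_zero,
      Finset.sum_eq_zero_iff_of_nonneg fun k _ => (hpsd k).trace_nonneg] at htr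
    have := htr m (Finset.mem_filter.2 ⟨hms, hm⟩)
    rw [Matrix.trace_vecMulVec, dotProduct_self_eq_zero] at this
    exact (Finset.mem_filter.1 hms).2 this
  · rw [hS i hi₁ hi₂, hX fun y => y ^ i • mass y]
    have hfib (y : ℝ) : y ^ i • mass y = ∑ m ∈ s with t m = y, t m ^ i • vecMulVec (w m) (w m) := by
      rw [Finset.smul_sum]
      exact Finset.sum_congr rfl fun m hm => by rw [(Finset.mem_filter.1 hm).2]
    simp_rw [hfib]
    rw [Finset.sum_fiberwise_of_maps_to hmaps]
    refine (Finset.sum_filter_of_ne (p := fun m => w m ≠ 0) fun m _ hm h0 => hm ?_).symm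
    simp [h0]
  · rw [hX fun y => (mass y).rank]
    calc ∑ y ∈ X, (mass y).rank ≤ ∑ y ∈ X, #{m ∈ s | t m = y} := by
          refine Finset.sum_le_sum fun y _ => (Matrix.rank_finset_sum_le _ _).trans ?_
          rw [Finset.card_eq_sum_ones]
          exact Finset.sum_le_sum fun m _ => Matrix.rank_vecMulVec_le _ _
      _ = #s := (Finset.card_eq_sum_card_fiberwise hmaps).symm
      _ ≤ r := by simpa using Finset.card_le_univ s

/-- The block column `(y ^ (i - n₁) I)_i` attached to an atom `y`. -/
noncomputable def powerColumn (n₁ n₂ p : ℕ) (y : ℝ) :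
    Matrix (Fin (n₁ + n₂ + 1) × Fin p) (Fin p) ℝ :=
  fun ia b => if ia.2 = b then y ^ ((ia.1.1 : ℤ) - n₁) else 0

theorem IsStrongRepMeasure.strongHankel_eq {ℓ : ℕ} {x : Fin ℓ → ℝ}
    {A : Fin ℓ → Matrix (Fin p) (Fin p) ℝ} (h : IsStrongRepMeasure n₁ n₂ p S ℓ x A) :
    strongHankel n₁ n₂ p S =
      ∑ k, powerColumn n₁ n₂ p (x k) * A k * (powerColumn n₁ n₂ p (x k))ᴴ := by
  obtain ⟨-, hx, -, -, hS⟩ := h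
  ext ⟨i, a⟩ ⟨j, b⟩
  have hi := i.2
  have hj := j.2
  rw [strongHankel, hS _ (by simp only; omega) (by simp only; omega), Matrix.sum_apply,
    Matrix.sum_apply]
  refine Finset.sum_congr rfl fun k _ => ?_
  have : ((i.1 : ℤ) + j.1 - 2 * n₁) = (i.1 - n₁) + (j.1 - n₁) := by ring
  simp only [Matrix.smul_apply, smul_eq_mul, this, zpow_add₀ (hx k), Matrix.mul_apply, powerColumn,
    Matrix.conjTranspose_apply, star_trivial, ite_mul, mul_ite, zero_mul, mul_zero,
    Finset.sum_ite_eq, Finset.mem_univ, if_true]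
  ring

theorem IsStrongRepMeasure.posSemidef_strongHankel {ℓ : ℕ} {x : Fin ℓ → ℝ}
    {A : Fin ℓ → Matrix (Fin p) (Fin p) ℝ} (h : IsStrongRepMeasure n₁ n₂ p S ℓ x A) :
    (strongHankel n₁ n₂ p S).PosSemidef := by
  rw [h.strongHankel_eq]
  exact posSemidef_sum _ fun k _ => (h.2.2.1 k).mul_mul_conjTranspose_same _

theorem IsStrongRepMeasure.rank_strongHankel_le {ℓ : ℕ} {x : Fin ℓ → ℝ}
    {A : Fin ℓ → Matrix (Fin p) (Fin p) ℝ} (h : IsStrongRepMeasure n₁ n₂ p S ℓ x A) :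
    (strongHankel n₁ n₂ p S).rank ≤ ∑ k, (A k).rank := by
  rw [h.strongHankel_eq]
  exact (Matrix.rank_finset_sum_le _ _).trans <| Finset.sum_le_sum fun k _ =>
    (Matrix.rank_mul_le_left _ _).trans (Matrix.rank_mul_le_right _ _)

/-- The quadratic form of the block Hankel matrix shifted by `c`, in terms of the measure. -/
theorem IsStrongRepMeasure.sum_dotProduct_eq {ℓ : ℕ} {x : Fin ℓ → ℝ}
    {A : Fin ℓ → Matrix (Fin p) (Fin p) ℝ} (h : IsStrongRepMeasure n₁ n₂ p S ℓ x A)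
    {c : ℤ} (hc₀ : 0 ≤ c) (hc₂ : c ≤ 2) (v : Fin (n₁ + n₂) → Fin p → ℝ) :
    ∑ i : Fin (n₁ + n₂), ∑ j : Fin (n₁ + n₂),
        v j ⬝ᵥ (S ((i.1 : ℤ) + (j.1 : ℤ) - 2 * (n₁ : ℤ) + c) *ᵥ v i) =
      ∑ k, x k ^ c * ((∑ i : Fin (n₁ + n₂), x k ^ ((i.1 : ℤ) - n₁) • v i) ⬝ᵥ
        (A k *ᵥ ∑ i : Fin (n₁ + n₂), x k ^ ((i.1 : ℤ) - n₁) • v i)) := by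
  obtain ⟨-, hx, -, -, hS⟩ := h
  have hterm (i j : Fin (n₁ + n₂)) :
      v j ⬝ᵥ (S ((i.1 : ℤ) + (j.1 : ℤ) - 2 * (n₁ : ℤ) + c) *ᵥ v i) =
        ∑ k, x k ^ c * ((x k ^ ((j.1 : ℤ) - n₁) • v j) ⬝ᵥ
          (A k *ᵥ (x k ^ ((i.1 : ℤ) - n₁) • v i))) := by
    have hi := i.2
    have hj := j.2
    rw [hS _ (by omega) (by omega), Matrix.sum_mulVec, dotProduct_sum]
    refine Finset.sum_congr rfl fun k _ => ?_
    have : ((i.1 : ℤ) + j.1 - 2 * n₁ + c) = c + ((j.1 - n₁) + (i.1 - n₁)) := by ring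
    rw [this, zpow_add₀ (hx k), zpow_add₀ (hx k), Matrix.smul_mulVec, Matrix.mulVec_smul,
      dotProduct_smul, dotProduct_smul, smul_dotProduct]
    simp only [smul_eq_mul]
    ring
  simp_rw [hterm]
  simp_rw [Matrix.mulVec_sum, sum_dotProduct, dotProduct_sum, Finset.mul_sum]
  rw [Finset.sum_comm]
  simp_rw [Finset.sum_comm (s := univ) (t := (univ : Finset (Fin ℓ)))]

theorem IsStrongRepMeasure.sum_dotProduct_eq_zero_iff {ℓ : ℕ} {x : Fin ℓ → ℝ}
    {A : Fin ℓ → Matrix (Fin p) (Fin p) ℝ} (h : IsStrongRepMeasure n₁ n₂ p S ℓ x A)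
    {c : ℤ} (hc₀ : 0 ≤ c) (hc₂ : c ≤ 2) (hc : Even c) (v : Fin (n₁ + n₂) → Fin p → ℝ) :
    ∑ i : Fin (n₁ + n₂), ∑ j : Fin (n₁ + n₂),
        v j ⬝ᵥ (S ((i.1 : ℤ) + (j.1 : ℤ) - 2 * (n₁ : ℤ) + c) *ᵥ v i) = 0 ↔
      ∀ k, (∑ i : Fin (n₁ + n₂), x k ^ ((i.1 : ℤ) - n₁) • v i) ⬝ᵥ
        (A k *ᵥ ∑ i : Fin (n₁ + n₂), x k ^ ((i.1 : ℤ) - n₁) • v i) = 0 := by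
  rw [h.sum_dotProduct_eq hc₀ hc₂, Finset.sum_eq_zero_iff_of_nonneg]
  · exact ⟨fun h0 k => (mul_eq_zero.1 (h0 k (mem_univ k))).resolve_left (zpow_ne_zero _ (h.2.1 k)),
      fun h0 k _ => by rw [h0 k, mul_zero]⟩
  · exact fun k _ => mul_nonneg (hc.zpow_nonneg _)
      (by simpa using (h.2.2.1 k).dotProduct_mulVec_nonneg _)

theorem dotProduct_strongHankelSub_mulVec (c : ℤ) (v : Fin (n₁ + n₂) × Fin p → ℝ) :
    v ⬝ᵥ (strongHankelSub n₁ n₂ p c S *ᵥ v) =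
      ∑ i : Fin (n₁ + n₂), ∑ j : Fin (n₁ + n₂),
        (fun a => v (j, a)) ⬝ᵥ
          (S ((i.1 : ℤ) + (j.1 : ℤ) - 2 * (n₁ : ℤ) + c) *ᵥ fun a => v (i, a)) := by
  rw [Finset.sum_comm]
  simp only [dotProduct, mulVec, strongHankelSub, Fintype.sum_prod_type]
  refine Finset.sum_congr rfl fun j _ => ?_
  rw [Finset.sum_comm]
  refine Finset.sum_congr rfl fun a _ => ?_
  rw [← Finset.mul_sum]
  congr 1
  refine Finset.sum_congr rfl fun i _ => ?_
  rw [add_comm (i.1 : ℤ)]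

theorem strongHankelSub_zero_eq_submatrix :
    strongHankelSub n₁ n₂ p 0 S = (strongHankel n₁ n₂ p S).submatrix
      (Prod.map Fin.castSucc id) (Prod.map Fin.castSucc id) := by
  ext ⟨i, a⟩ ⟨j, b⟩
  simp [strongHankel, strongHankelSub]

theorem strongHankelSub_two_eq_submatrix :
    strongHankelSub n₁ n₂ p 2 S = (strongHankel n₁ n₂ p S).submatrix
      (Prod.map Fin.succ id) (Prod.map Fin.succ id) := by
  ext ⟨i, a⟩ ⟨j, b⟩
  simp only [strongHankel, strongHankelSub, Matrix.submatrix_apply, Prod.map, Fin.val_succ, id]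
  congr 1
  push_cast
  ring

theorem strongHankel_submatrix_succ_castSucc :
    (strongHankel n₁ n₂ p S).submatrix (Prod.map Fin.succ id) (Prod.map Fin.castSucc id) =
      (strongHankel n₁ n₂ p S).submatrix (Prod.map Fin.castSucc id) (Prod.map Fin.succ id) := by
  ext ⟨i, a⟩ ⟨j, b⟩
  simp only [strongHankel, Matrix.submatrix_apply, Prod.map, Fin.val_succ, Fin.val_castSucc, id]
  congr 1
  push_cast
  ring

theorem strongHankelSub_mulVec_eq_zero_iff {c : ℤ}
    (h : (strongHankelSub n₁ n₂ p c S).PosSemidef) (v : Fin (n₁ + n₂) × Fin p → ℝ) :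
    strongHankelSub n₁ n₂ p c S *ᵥ v = 0 ↔
      ∑ i : Fin (n₁ + n₂), ∑ j : Fin (n₁ + n₂),
        (fun a => v (j, a)) ⬝ᵥ
          (S ((i.1 : ℤ) + (j.1 : ℤ) - 2 * (n₁ : ℤ) + c) *ᵥ fun a => v (i, a)) = 0 := by
  rw [← dotProduct_strongHankelSub_mulVec, ← h.dotProduct_mulVec_zero_iff, star_trivial]

end Representation

theorem inner_linearCombination_comp {ι κ E : Type*} [Fintype κ] [NormedAddCommGroup E]
    [InnerProductSpace ℝ E] {H : Matrix ι ι ℝ} {g : ι → E}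
    (hg : ∀ a b, inner ℝ (g a) (g b) = H a b) (e f : κ → ι) (v w : κ → ℝ) :
    inner ℝ (Fintype.linearCombination ℝ (g ∘ e) v) (Fintype.linearCombination ℝ (g ∘ f) w) =
      v ⬝ᵥ (H.submatrix e f *ᵥ w) := by
  simp only [Fintype.linearCombination_apply, sum_inner, inner_sum, inner_smul_left,
    inner_smul_right, Function.comp_apply, hg, dotProduct, mulVec, Matrix.submatrix_apply,
    Finset.mul_sum, conj_trivial]
  rw [Finset.sum_comm]
  exact Finset.sum_congr rfl fun a _ => Finset.sum_congr rfl fun b _ => by ring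

theorem linearCombination_comp_eq_zero_iff {ι κ E : Type*} [Fintype κ] [NormedAddCommGroup E]
    [InnerProductSpace ℝ E] {H : Matrix ι ι ℝ} (hH : H.PosSemidef) {g : ι → E}
    (hg : ∀ a b, inner ℝ (g a) (g b) = H a b) (e : κ → ι) (v : κ → ℝ) :
    Fintype.linearCombination ℝ (g ∘ e) v = 0 ↔ H.submatrix e e *ᵥ v = 0 := by
  rw [← inner_self_eq_zero (𝕜 := ℝ), inner_linearCombination_comp hg,
    ← (hH.submatrix e).dotProduct_mulVec_zero_iff, star_trivial]

/-- A positive semidefinite block Hankel matrix satisfying the kernel condition has a representing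
measure whose total rank is at most the rank of the matrix. -/
theorem exists_isStrongRepMeasure_of_ker_eq {n₁ n₂ p : ℕ} {S : ℤ → Matrix (Fin p) (Fin p) ℝ}
    (hH : (strongHankel n₁ n₂ p S).PosSemidef)
    (hker : ∀ v : Fin (n₁ + n₂) × Fin p → ℝ,
      strongHankelSub n₁ n₂ p 0 S *ᵥ v = 0 ↔ strongHankelSub n₁ n₂ p 2 S *ᵥ v = 0) :
    ∃ (ℓ : ℕ) (x : Fin ℓ → ℝ) (A : Fin ℓ → Matrix (Fin p) (Fin p) ℝ),
      IsStrongRepMeasure n₁ n₂ p S ℓ x A ∧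
        ∑ j, (A j).rank ≤ (strongHankel n₁ n₂ p S).rank := by
  obtain ⟨g, hg⟩ := hH.exists_gram
  obtain ⟨M, hM, hMinj, hMg⟩ := exists_isSymmetric_injective_extension
    (Fintype.linearCombination ℝ (g ∘ Prod.map (Fin.castSucc (n := n₁ + n₂)) id))
    (Fintype.linearCombination ℝ (g ∘ Prod.map (Fin.succ (n := n₁ + n₂)) id))
    (fun v => by
      rw [linearCombination_comp_eq_zero_iff hH hg, linearCombination_comp_eq_zero_iff hH hg,
        ← strongHankelSub_zero_eq_submatrix, ← strongHankelSub_two_eq_submatrix, hker])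
    (fun v w => by
      rw [inner_linearCombination_comp hg, inner_linearCombination_comp hg,
        strongHankel_submatrix_succ_castSucc])
  have hfin : Module.finrank ℝ (EuclideanSpace ℝ (Fin (strongHankel n₁ n₂ p S).rank)) =
      (strongHankel n₁ n₂ p S).rank := finrank_euclideanSpace_fin
  let b := hM.eigenvectorBasis hfin
  let t := hM.eigenvalues hfin
  have hMb (m) : M (b m) = t m • b m := hM.apply_eigenvectorBasis hfin m
  have ht (m) : t m ≠ 0 := by
    intro h0
    refine b.orthonormal.ne_zero m (hMinj ?_)
    rw [hMb, h0, zero_smul, map_zero]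
  have hstep (i : Fin (n₁ + n₂)) (a : Fin p) : M (g (i.castSucc, a)) = g (i.succ, a) := by
    simpa [Fintype.linearCombination_apply_single] using hMg (Pi.single (i, a) 1)
  have hcoeff (m) (i : Fin (n₁ + n₂ + 1)) (a : Fin p) :
      inner ℝ (b m) (g (i, a)) = t m ^ (i : ℕ) * inner ℝ (b m) (g (0, a)) := by
    induction i using Fin.induction with
    | zero => simp
    | succ i ih =>
      rw [← hstep, ← hM, hMb, inner_smul_left, ih, Fin.val_succ, pow_succ']
      simp [mul_assoc]
  refine exists_isStrongRepMeasure_of_sum_vecMulVec t ht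
    (fun m a => t m ^ (n₁ : ℤ) * inner ℝ (b m) (g (0, a))) fun k hk₁ hk₂ => ?_
  obtain ⟨i, j, hij⟩ : ∃ i j : Fin (n₁ + n₂ + 1), (i.1 : ℤ) + j.1 - 2 * n₁ = k := by
    rcases le_total k (n₂ - n₁) with h | h
    · exact ⟨⟨(k + 2 * n₁).toNat, by omega⟩, 0, by simp; omega⟩
    · exact ⟨⟨(k + n₁ - n₂).toNat, by omega⟩, Fin.last _, by simp; omega⟩
  ext a c
  have hentry : S k a c = inner ℝ (g (i, a)) (g (j, c)) := by
    rw [hg, strongHankel, hij]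
  rw [hentry, ← b.sum_inner_mul_inner, Matrix.sum_apply]
  refine Finset.sum_congr rfl fun m _ => ?_
  have hpow : t m ^ k * (t m ^ (n₁ : ℤ) * t m ^ (n₁ : ℤ)) = t m ^ i.1 * t m ^ j.1 := by
    simp only [← zpow_natCast, ← zpow_add₀ (ht m)]
    congr 1
    omega
  rw [real_inner_comm, hcoeff m i, hcoeff m j, Matrix.smul_apply, vecMulVec_apply, smul_eq_mul]
  linear_combination (-inner ℝ (b m) (g (0, a)) * inner ℝ (b m) (g (0, c))) * hpow

/-- **Corollary 1.4** (strong truncated Hamburger matrix moment problem). -/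
theorem strong_hamburger (n₁ n₂ p : ℕ) (hn₁ : 1 ≤ n₁) (hn₂ : 1 ≤ n₂) (hp : 0 < p)
    (S : ℤ → Matrix (Fin p) (Fin p) ℝ)
    (hsymm : ∀ i : ℤ, -(2 * (n₁ : ℤ)) ≤ i → i ≤ 2 * (n₂ : ℤ) → (S i).IsSymm) :
    [(∃ (ℓ : ℕ) (x : Fin ℓ → ℝ) (A : Fin ℓ → Matrix (Fin p) (Fin p) ℝ),
        IsStrongRepMeasure n₁ n₂ p S ℓ x A),
      (∃ (ℓ : ℕ) (x : Fin ℓ → ℝ) (A : Fin ℓ → Matrix (Fin p) (Fin p) ℝ),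
        IsStrongRepMeasure n₁ n₂ p S ℓ x A ∧
          (∑ j, (A j).rank) = (strongHankel n₁ n₂ p S).rank),
      ((strongHankel n₁ n₂ p S).PosSemidef ∧
        ∀ v : Fin (n₁ + n₂) × Fin p → ℝ,
          (strongHankelSub n₁ n₂ p 0 S).mulVec v = 0 ↔
            (strongHankelSub n₁ n₂ p 2 S).mulVec v = 0),
      ((strongHankel n₁ n₂ p S).PosSemidef ∧
        ∀ v : Fin (n₁ + n₂) → Fin p → ℝ,
          ((∑ i : Fin (n₁ + n₂), ∑ j : Fin (n₁ + n₂),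
              dotProduct (v j)
                ((S ((i.1 : ℤ) + (j.1 : ℤ) - 2 * (n₁ : ℤ))).mulVec (v i))) = 0 ↔
            (∑ i : Fin (n₁ + n₂), ∑ j : Fin (n₁ + n₂),
              dotProduct (v j)
                ((S ((i.1 : ℤ) + (j.1 : ℤ) - 2 * (n₁ : ℤ) + 2)).mulVec (v i))) = 0))].TFAE := by
  tfae_have 2 → 1 := fun ⟨ℓ, x, A, h, _⟩ => ⟨ℓ, x, A, h⟩
  tfae_have 1 → 4 := by
    rintro ⟨ℓ, x, A, h⟩
    refine ⟨h.posSemidef_strongHankel, fun v => ?_⟩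
    have h₀ := h.sum_dotProduct_eq_zero_iff (c := 0) le_rfl (by norm_num) (by decide) v
    simp only [add_zero] at h₀
    rw [h₀, h.sum_dotProduct_eq_zero_iff (c := 2) (by norm_num) le_rfl (by decide) v]
  tfae_have 4 → 3 := by
    rintro ⟨hH, h⟩
    refine ⟨hH, fun v => ?_⟩
    rw [strongHankelSub_mulVec_eq_zero_iff
        (strongHankelSub_zero_eq_submatrix (S := S) ▸ hH.submatrix _),
      strongHankelSub_mulVec_eq_zero_iff
        (strongHankelSub_two_eq_submatrix (S := S) ▸ hH.submatrix _)]
    simpa only [add_zero] using h fun i a => v (i, a)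
  tfae_have 3 → 2 := by
    rintro ⟨hH, hker⟩
    obtain ⟨ℓ, x, A, h, hrank⟩ := exists_isStrongRepMeasure_of_ker_eq hH hker
    exact ⟨ℓ, x, A, h, hrank.antisymm h.rank_strongHankel_le⟩
  tfae_finish
end

section
/- Let n ≥ 1, p ≥ 1, let 𝒮 = (S_0,…,S_{2n}) in 𝕊_p(ℝ) and let μ = (ℓ; x_1,…,x_ℓ; A_1,…,A_ℓ) be a representing measure for 𝒮. Suppose H(x) = Σ_{i=0}^{n} x^i H_i with H_i ∈ M_p(ℝ) and H_n invertible is a block column relation of M(n), i.e., Σ_{i=0}^{n} X^i H_i = 0. Then for every j ∈ {1,…,ℓ}: det H(x_j) = 0 and rank A_j is at most the multiplicity of x_j as a root of the (nonzero) polynomial det H(x). In particular every atom of μ is a zero of det H. -/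
open Finset Matrix Polynomial

/-- The `i`-th block column `X^i = col(S_i, …, S_{i+n})` of the moment matrix `M(n)`. -/
def blockCol (n p : ℕ) (S : ℕ → Matrix (Fin p) (Fin p) ℝ) (i : ℕ) :
    Matrix (Fin (n + 1) × Fin p) (Fin p) ℝ :=
  fun rb c => S (rb.1.1 + i) rb.2 c

/-- The determinant of the matrix polynomial `H(x) = ∑_{i=0}^{n} x^i H_i`, as an element
of `ℝ[X]`. -/
noncomputable def detMatPoly (n p : ℕ) (H : ℕ → Matrix (Fin p) (Fin p) ℝ) :
    Polynomial ℝ :=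
  Matrix.det (fun a b => ∑ i ∈ Finset.range (n + 1),
    Polynomial.C (H i a b) * Polynomial.X ^ i : Matrix (Fin p) (Fin p) (Polynomial ℝ))

/-- If psd matrices `A j` satisfy `∑ j, (B j)ᵀ * A j * B j = 0`, then every `A j * B j` vanishes. -/
lemma Matrix.PosSemidef.mul_eq_zero_of_sum_transpose_mul_mul_eq_zero {ι m k : Type*} [Fintype ι]
    [Fintype m] [Fintype k] {A : ι → Matrix m m ℝ} {B : ι → Matrix m k ℝ}
    (hA : ∀ j, (A j).PosSemidef) (h : ∑ j, (B j)ᵀ * A j * B j = 0) (j : ι) :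
    A j * B j = 0 := by
  classical
  refine Matrix.ext_of_mulVec_single fun c => ?_
  set v : k → ℝ := Pi.single c 1
  have hsum : ∑ i, star (B i *ᵥ v) ⬝ᵥ (A i *ᵥ (B i *ᵥ v)) = 0 := by
    have hv := congrArg (fun M => v ⬝ᵥ (M *ᵥ v)) h
    simp only [Matrix.sum_mulVec, dotProduct_sum, zero_mulVec, dotProduct_zero] at hv
    rw [← hv]
    refine Finset.sum_congr rfl fun i _ => ?_
    rw [star_trivial, ← mulVec_mulVec, ← mulVec_mulVec, dotProduct_mulVec v, vecMul_transpose]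
  have hj := (Finset.sum_eq_zero_iff_of_nonneg
    fun i _ => (hA i).dotProduct_mulVec_nonneg (B i *ᵥ v)).1 hsum j (Finset.mem_univ j)
  rw [zero_mulVec, ← mulVec_mulVec]
  exact ((hA j).dotProduct_mulVec_zero_iff _).1 hj

/-- If the rows indexed by `s` of a polynomial matrix vanish at `a`, then `(X - C a) ^ #s` divides
its determinant. -/
lemma Matrix.pow_card_dvd_det_of_rows_isRoot {R m : Type*} [CommRing R] [Fintype m] [DecidableEq m]
    (M : Matrix m m R[X]) (a : R) (s : Finset m) (h : ∀ i ∈ s, ∀ k, (M i k).IsRoot a) :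
    (X - C a) ^ #s ∣ M.det := by
  have hdvd : ∀ i k, ∃ q, M i k = (if i ∈ s then X - C a else 1) * q := fun i k => by
    by_cases hi : i ∈ s
    · simpa [hi, Dvd.dvd] using dvd_iff_isRoot.2 (h i hi k)
    · simp [hi]
  choose N hN using hdvd
  have hM : M = diagonal (fun i => if i ∈ s then X - C a else 1) * Matrix.of N := by
    ext1 i k
    rw [diagonal_mul, of_apply, hN]
  rw [hM, det_mul, det_diagonal, Finset.prod_ite_mem, Finset.univ_inter, Finset.prod_const]
  exact dvd_mul_right _ _

/-- If a Hermitian matrix `A` annihilates the value at `a` of a polynomial matrix `M` from the left,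
then `(X - C a) ^ A.rank` divides `M.det`. -/
lemma Matrix.IsHermitian.pow_rank_dvd_det {m : Type*} [Fintype m] [DecidableEq m]
    {A : Matrix m m ℝ} (hA : A.IsHermitian) (M : Matrix m m ℝ[X]) (a : ℝ)
    (h : A * M.map (eval a) = 0) : (X - C a) ^ A.rank ∣ M.det := by
  set U : Matrix m m ℝ := hA.eigenvectorUnitary.1
  have hU : U * star U = 1 := Unitary.coe_mul_star_self hA.eigenvectorUnitary
  have hdiag : diagonal hA.eigenvalues * star U = star U * A := by
    have hD : star U * A * U = diagonal hA.eigenvalues := by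
      simpa [Unitary.conjStarAlgAut_star_apply] using hA.conjStarAlgAut_star_eigenvectorUnitary
    rw [← hD, mul_assoc, hU, mul_one]
  have hzero : diagonal hA.eigenvalues * (star U * M.map (eval a)) = 0 := by
    rw [← mul_assoc, hdiag, mul_assoc, h, mul_zero]
  have hrow : ∀ i ∈ univ.filter (fun i => hA.eigenvalues i ≠ 0), ∀ k,
      (((star U).map C * M) i k).IsRoot a := fun i hi k => by
    have hik := congrFun (congrFun hzero i) k
    rw [diagonal_mul, Matrix.zero_apply] at hik
    have := (mul_eq_zero.1 hik).resolve_left (Finset.mem_filter.1 hi).2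
    simpa [IsRoot, Matrix.mul_apply, eval_finsetSum] using this
  have hunit : IsUnit ((star U).map C).det := by
    have : ((star U).map C).det = C (star U).det := (RingHom.map_det C (star U)).symm
    rw [this, isUnit_C, ← Matrix.isUnit_iff_isUnit_det]
    exact IsUnit.of_mul_eq_one_right _ hU
  have hdvd := pow_card_dvd_det_of_rows_isRoot _ a _ hrow
  rw [det_mul, hunit.dvd_mul_left] at hdvd
  rwa [hA.rank_eq_card_non_zero_eigs, Fintype.card_subtype]

lemma detMatPoly_eq_det (n p : ℕ) (H : ℕ → Matrix (Fin p) (Fin p) ℝ) :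
    detMatPoly n p H =
      (Matrix.of fun a b => ∑ i ∈ Finset.range (n + 1), C (H i a b) * X ^ i).det :=
  rfl

/-- The coefficient of degree `n * p` of `det (∑ x ^ i H_i)` is `det H_n`. -/
lemma coeff_detMatPoly (n p : ℕ) (H : ℕ → Matrix (Fin p) (Fin p) ℝ) :
    (detMatPoly n p H).coeff (p * n) = (H n).det := by
  rw [detMatPoly_eq_det, det_apply, det_apply, finsetSum_coeff]
  refine Finset.sum_congr rfl fun σ _ => ?_
  rw [coeff_smul]
  congr 1
  have hprod := coeff_prod_of_natDegree_le (s := univ)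
    (fun k => ∑ i ∈ Finset.range (n + 1), C (H i (σ k) k) * X ^ i) n fun k _ =>
      natDegree_sum_le_of_forall_le _ _ fun i hi => (natDegree_C_mul_X_pow_le _ _).trans
        (Nat.lt_succ_iff.1 (Finset.mem_range.1 hi))
  rw [Finset.card_univ, Fintype.card_fin] at hprod
  simp only [of_apply, hprod]
  refine Finset.prod_congr rfl fun k _ => ?_
  simp [finsetSum_coeff, coeff_X_pow]

/-- A block column relation of the moment matrix is annihilated from the left, at each atom of a
representing measure, by the mass of that atom. -/
lemma mass_mul_eval_eq_zero {n p ℓ : ℕ} {S : ℕ → Matrix (Fin p) (Fin p) ℝ} {x : Fin ℓ → ℝ}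
    {A : Fin ℓ → Matrix (Fin p) (Fin p) ℝ} (hpsd : ∀ j, (A j).PosSemidef)
    (hmom : ∀ i, i ≤ 2 * n → S i = ∑ j, x j ^ i • A j) {H : ℕ → Matrix (Fin p) (Fin p) ℝ}
    (hrel : (∑ i ∈ Finset.range (n + 1), blockCol n p S i * H i) = 0) (j : Fin ℓ) :
    A j * ∑ i ∈ Finset.range (n + 1), x j ^ i • H i = 0 := by
  have hrow : ∀ r ∈ Finset.range (n + 1), ∑ i ∈ Finset.range (n + 1), S (r + i) * H i = 0 := by
    intro r hr
    ext b c
    have := congrFun (congrFun hrel (⟨r, Finset.mem_range.1 hr⟩, b)) c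
    simpa [Matrix.sum_apply, Matrix.mul_apply, blockCol] using this
  have hatoms : ∀ r ∈ Finset.range (n + 1),
      ∑ j, x j ^ r • (A j * ∑ i ∈ Finset.range (n + 1), x j ^ i • H i) = 0 := by
    intro r hr
    rw [← hrow r hr]
    simp only [Finset.mul_sum, Finset.smul_sum]
    rw [Finset.sum_comm]
    refine Finset.sum_congr rfl fun i hi => ?_
    rw [Finset.mem_range] at hr hi
    rw [hmom (r + i) (by omega), Finset.sum_mul]
    exact Finset.sum_congr rfl fun j _ => by
      rw [Matrix.mul_smul, smul_smul, pow_add, Matrix.smul_mul]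
  refine PosSemidef.mul_eq_zero_of_sum_transpose_mul_mul_eq_zero hpsd
    (B := fun j => ∑ i ∈ Finset.range (n + 1), x j ^ i • H i) ?_ j
  calc ∑ j, (∑ r ∈ Finset.range (n + 1), x j ^ r • H r)ᵀ * A j *
        (∑ i ∈ Finset.range (n + 1), x j ^ i • H i)
      = ∑ r ∈ Finset.range (n + 1), (H r)ᵀ *
          ∑ j, x j ^ r • (A j * ∑ i ∈ Finset.range (n + 1), x j ^ i • H i) := by
        simp only [Finset.mul_sum (s := (univ : Finset (Fin ℓ)))]
        rw [Finset.sum_comm]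
        refine Finset.sum_congr rfl fun j _ => ?_
        rw [Matrix.transpose_sum, mul_assoc, Finset.sum_mul]
        exact Finset.sum_congr rfl fun r _ => by
          rw [transpose_smul, Matrix.smul_mul, Matrix.mul_smul]
    _ = 0 := Finset.sum_eq_zero fun r hr => by rw [hatoms r hr, mul_zero]

/-- **Lemma 2.2**: if `H(x) = ∑ x^i H_i` with `H_n` invertible is a block column relation
of `M(n)`, then every atom of a representing measure is a zero of `det H`, with the rank
of its mass bounded by the root multiplicity. -/
theorem atoms_in_det_zeros (n p : ℕ) (hn : 1 ≤ n) (hp : 0 < p)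
    (S : ℕ → Matrix (Fin p) (Fin p) ℝ)
    (ℓ : ℕ) (x : Fin ℓ → ℝ) (A : Fin ℓ → Matrix (Fin p) (Fin p) ℝ)
    (hx : Function.Injective x) (hpsd : ∀ j, (A j).PosSemidef) (hA0 : ∀ j, A j ≠ 0)
    (hmom : ∀ i, i ≤ 2 * n → S i = ∑ j, x j ^ i • A j)
    (H : ℕ → Matrix (Fin p) (Fin p) ℝ) (hHn : IsUnit (H n))
    (hrel : (∑ i ∈ Finset.range (n + 1), blockCol n p S i * H i) = 0) :
    detMatPoly n p H ≠ 0 ∧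
      ∀ j, (detMatPoly n p H).eval (x j) = 0 ∧
        (A j).rank ≤ (detMatPoly n p H).rootMultiplicity (x j) := by
  have hne : detMatPoly n p H ≠ 0 := fun h0 => by
    have hcoeff := coeff_detMatPoly n p H
    rw [h0, coeff_zero] at hcoeff
    exact ((Matrix.isUnit_iff_isUnit_det _).1 hHn).ne_zero hcoeff.symm
  refine ⟨hne, fun j => ?_⟩
  have hrank : (A j).rank ≤ (detMatPoly n p H).rootMultiplicity (x j) := by
    rw [le_rootMultiplicity_iff hne, detMatPoly_eq_det]
    refine IsHermitian.pow_rank_dvd_det (hpsd j).isHermitian _ _ ?_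
    rw [← mass_mul_eval_eq_zero hpsd hmom hrel j]
    congr 1
    ext a b
    simp [eval_finsetSum, Matrix.sum_apply, mul_comm (H _ a b)]
  refine ⟨?_, hrank⟩
  have hpos : 0 < (A j).rank := Nat.pos_of_ne_zero fun h0 => hA0 j <| by
    rw [Matrix.rank, Submodule.finrank_eq_zero, LinearMap.range_eq_bot] at h0
    exact Matrix.toLin'.injective (by rw [toLin'_apply', h0, map_zero])
  exact (rootMultiplicity_pos hne).1 (hpos.trans_le hrank)
end

section
/- Let n ≥ 1, p ≥ 1 and let 𝒮 = (S_0,…,S_{2n}) in 𝕊_p(ℝ) admit a representing measure. Then M(n) is block-recursively generated: for every matrix polynomial P(x) = Σ_{i=0}^{j} x^i P_i with P_i ∈ M_p(ℝ) and 0 ≤ j < n, if Σ_{i=0}^{j} X^i P_i = 0 then also Σ_{i=0}^{j} X^{i+1} P_i = 0. -/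
open Finset Matrix

/-- If the congruences `(Q k)ᴴ * A k * Q k` of psd matrices sum to zero, then every `A k * Q k`
vanishes. -/
theorem mul_eq_zero_of_sum_conjTranspose_mul_mul_eq_zero {ι m q : Type*} [Fintype ι] [Fintype m]
    [Fintype q] {A : ι → Matrix m m ℝ} {Q : ι → Matrix m q ℝ} (hA : ∀ k, (A k).PosSemidef)
    (h : ∑ k, (Q k)ᴴ * A k * Q k = 0) (k : ι) : A k * Q k = 0 := by
  have hpsd : ∀ i, ((Q i)ᴴ * A i * Q i).PosSemidef := fun i =>
    (hA i).conjTranspose_mul_mul_same (Q i)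
  have htrace : ∑ i, ((Q i)ᴴ * A i * Q i).trace = 0 := by
    rw [← Matrix.trace_sum, h, Matrix.trace_zero]
  have hk : (Q k)ᴴ * A k * Q k = 0 := (hpsd k).trace_eq_zero_iff.mp <|
    (Finset.sum_eq_zero_iff_of_nonneg fun i _ => (hpsd i).trace_nonneg).mp htrace k
      (Finset.mem_univ k)
  have hcol : ∀ c, A k *ᵥ (Q k).col c = 0 := fun c => by
    rw [← (hA k).dotProduct_mulVec_zero_iff]
    have hcc := congrFun (congrFun hk c) c
    rwa [Matrix.mul_assoc] at hcc
  ext b c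
  exact congrFun (hcol c) b

/-- **Proposition 2.3**: if `S_0, …, S_{2n}` admits a (finitely atomic) representing
measure, then `M(n)` is block-recursively generated: any block column relation
`∑_{i=0}^{j} X^i P_i = 0` with `j < n` propagates to `∑_{i=0}^{j} X^{i+1} P_i = 0`. -/
theorem block_recursively_generated (n p : ℕ) (hn : 1 ≤ n) (hp : 0 < p)
    (S : ℕ → Matrix (Fin p) (Fin p) ℝ)
    (ℓ : ℕ) (x : Fin ℓ → ℝ) (A : Fin ℓ → Matrix (Fin p) (Fin p) ℝ)
    (hx : Function.Injective x) (hpsd : ∀ j, (A j).PosSemidef) (hA0 : ∀ j, A j ≠ 0)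
    (hmom : ∀ i, i ≤ 2 * n → S i = ∑ j, x j ^ i • A j) :
    ∀ j, j < n → ∀ P : ℕ → Matrix (Fin p) (Fin p) ℝ,
      (∑ i ∈ Finset.range (j + 1), blockCol n p S i * P i) = 0 →
      (∑ i ∈ Finset.range (j + 1), blockCol n p S (i + 1) * P i) = 0 := by
  intro j hj P h
  set Q : Fin ℓ → Matrix (Fin p) (Fin p) ℝ := fun k => ∑ i ∈ Finset.range (j + 1), x k ^ i • P i
    with hQ
  have hrow : ∀ s (r : Fin (n + 1)), s ≤ 1 →
      (∑ i ∈ Finset.range (j + 1), S (r + (i + s)) * P i) = ∑ k, x k ^ (r + s : ℕ) • (A k * Q k) := by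
    intro s r hs
    simp only [hQ, Matrix.mul_sum, Finset.smul_sum]
    rw [Finset.sum_comm]
    refine Finset.sum_congr rfl fun i hi => ?_
    have hi' := Finset.mem_range.mp hi
    have hr := r.2
    rw [hmom _ (by omega), Matrix.sum_mul]
    refine Finset.sum_congr rfl fun k _ => ?_
    rw [Matrix.smul_mul, Matrix.mul_smul, smul_smul, ← pow_add]
    congr 2
    ring
  have hzero : ∀ r : Fin (n + 1), ∑ k, x k ^ (r : ℕ) • (A k * Q k) = 0 := by
    intro r
    rw [← add_zero (r : ℕ), ← hrow 0 r zero_le_one]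
    ext b c
    have hbc := congrFun (congrFun h (r, b)) c
    simpa [Matrix.sum_apply, Matrix.mul_apply, blockCol] using hbc
  have hsum : ∑ k, (Q k)ᴴ * A k * Q k = 0 := by
    calc ∑ k, (Q k)ᴴ * A k * Q k
        = ∑ i ∈ Finset.range (j + 1), (P i)ᴴ * ∑ k, x k ^ i • (A k * Q k) := by
          simp only [Matrix.mul_sum]
          rw [Finset.sum_comm]
          refine Finset.sum_congr rfl fun k _ => ?_
          rw [Matrix.mul_assoc]
          conv_lhs => enter [1]; rw [hQ]
          simp [Matrix.transpose_sum, Matrix.sum_mul]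
      _ = 0 := Finset.sum_eq_zero fun i hi => by
          have hi' := Finset.mem_range.mp hi
          rw [hzero ⟨i, by omega⟩, Matrix.mul_zero]
  have hAQ : ∀ k, A k * Q k = 0 := fun k =>
    mul_eq_zero_of_sum_conjTranspose_mul_mul_eq_zero hpsd hsum k
  ext ⟨r, b⟩ c
  have hbc := congrFun (congrFun (hrow 1 r le_rfl) b) c
  simpa [hAQ, Matrix.sum_apply, Matrix.mul_apply, blockCol] using hbc
end

section
/- Let n ≥ 1, p ≥ 1 and let 𝒮 = (S_0,…,S_{2n}) in 𝕊_p(ℝ) admit a representing measure. Then for all i ∈ {0,…,n−1}: 0 ≤ Card Dep(X^i) ≤ Card Dep(X^{i+1}) ≤ p. -/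
open Finset Matrix

/-- The `j`-th column (1-based, `1 ≤ j ≤ (n+1)p`) of the moment matrix
`M(n) = (S_{i+j-2})_{i,j=1}^{n+1}`. -/
def colMM (n p : ℕ) (hp : 0 < p) (S : ℕ → Matrix (Fin p) (Fin p) ℝ) (j : ℕ) :
    Fin (n + 1) × Fin p → ℝ :=
  fun ia => S (ia.1.1 + (j - 1) / p) ia.2 ⟨(j - 1) % p, Nat.mod_lt _ hp⟩

/-- `Dep(X^i)`: the set of indices `j ∈ {1,…,p}` such that the `j`-th column of the
block column `X^i` lies in the span of all preceding columns of `M(n)`. -/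
def depSet (n p : ℕ) (hp : 0 < p) (S : ℕ → Matrix (Fin p) (Fin p) ℝ) (i : ℕ) :
    Set ℕ :=
  {j | j ∈ Set.Icc 1 p ∧
    colMM n p hp S (i * p + j) ∈
      Submodule.span ℝ (colMM n p hp S '' Set.Icc 1 (i * p + j - 1))}

namespace MomentMatrix

variable {ℓ p : ℕ}

/-- The coefficient vector of the `k`-th column (1-based) of a moment matrix, viewed as a
vector polynomial and evaluated at the atoms. -/
def evalUnit (hp : 0 < p) (x : Fin ℓ → ℝ) (k : ℕ) : Fin ℓ → Fin p → ℝ :=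
  fun a => x a ^ ((k - 1) / p) • Pi.single ⟨(k - 1) % p, Nat.mod_lt _ hp⟩ 1

/-- Apply the mass `A a` to the component at the atom `a`. -/
def massMap (A : Fin ℓ → Matrix (Fin p) (Fin p) ℝ) :
    (Fin ℓ → Fin p → ℝ) →ₗ[ℝ] (Fin ℓ → Fin p → ℝ) :=
  LinearMap.pi fun a => (A a).mulVecLin ∘ₗ LinearMap.proj a

/-- Multiplication of the component at each atom by the location of that atom. -/
def shiftMap (x : Fin ℓ → ℝ) : (Fin ℓ → Fin p → ℝ) →ₗ[ℝ] (Fin ℓ → Fin p → ℝ) :=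
  LinearMap.pi fun a => x a • LinearMap.proj a

/-- The vector of moments of orders `0, …, n` of a vector valued measure on the atoms. -/
def momentMap (n : ℕ) (x : Fin ℓ → ℝ) :
    (Fin ℓ → Fin p → ℝ) →ₗ[ℝ] (Fin (n + 1) × Fin p → ℝ) :=
  LinearMap.pi fun ia => ∑ a, x a ^ ia.1.1 •
    ((LinearMap.proj ia.2 : (Fin p → ℝ) →ₗ[ℝ] ℝ) ∘ₗ LinearMap.proj a)

@[simp]
lemma massMap_apply (A : Fin ℓ → Matrix (Fin p) (Fin p) ℝ) (u : Fin ℓ → Fin p → ℝ)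
    (a : Fin ℓ) : massMap A u a = A a *ᵥ u a := rfl

@[simp]
lemma shiftMap_apply (x : Fin ℓ → ℝ) (u : Fin ℓ → Fin p → ℝ) (a : Fin ℓ) :
    shiftMap x u a = x a • u a := rfl

@[simp]
lemma momentMap_apply (n : ℕ) (x : Fin ℓ → ℝ) (w : Fin ℓ → Fin p → ℝ)
    (ia : Fin (n + 1) × Fin p) :
    momentMap n x w ia = ∑ a, x a ^ ia.1.1 * w a ia.2 := by
  simp [momentMap]

lemma shiftMap_massMap_evalUnit (hp : 0 < p) (x : Fin ℓ → ℝ)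
    (A : Fin ℓ → Matrix (Fin p) (Fin p) ℝ) {k : ℕ} (hk : 1 ≤ k) :
    shiftMap x (massMap A (evalUnit hp x k)) = massMap A (evalUnit hp x (k + p)) := by
  have hsub : k + p - 1 = k - 1 + p := by omega
  ext a b
  simp [evalUnit, hsub, Nat.add_div_right _ hp, pow_succ, mulVec_smul]
  ring

lemma index_div_lt {n p k : ℕ} (hp : 0 < p) (hk : k ∈ Set.Icc 1 ((n + 1) * p)) :
    (k - 1) / p < n + 1 := by
  rw [Nat.div_lt_iff_lt_mul hp]
  have := hk.1
  have := hk.2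
  omega

lemma colMM_eq_momentMap {n : ℕ} (hp : 0 < p) {S : ℕ → Matrix (Fin p) (Fin p) ℝ}
    {x : Fin ℓ → ℝ} {A : Fin ℓ → Matrix (Fin p) (Fin p) ℝ}
    (hmom : ∀ i, i ≤ 2 * n → S i = ∑ j, x j ^ i • A j)
    {k : ℕ} (hk : k ∈ Set.Icc 1 ((n + 1) * p)) :
    colMM n p hp S k = momentMap n x (massMap A (evalUnit hp x k)) := by
  have hdiv := index_div_lt hp hk
  ext ia
  have hia := ia.1.2
  rw [colMM, hmom _ (by omega), Matrix.sum_apply, momentMap_apply]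
  refine Finset.sum_congr rfl fun a _ => ?_
  simp [evalUnit, pow_add, mulVec_smul, mul_assoc]

/-- If all moments of the masses `A a *ᵥ u a` vanish, where `u` is a vector polynomial of degree
at most `n` evaluated at the atoms, then the masses themselves vanish. -/
lemma massMap_eq_zero_of_momentMap_eq_zero {n : ℕ} (hp : 0 < p) {x : Fin ℓ → ℝ}
    {A : Fin ℓ → Matrix (Fin p) (Fin p) ℝ} (hpsd : ∀ j, (A j).PosSemidef)
    {u : Fin ℓ → Fin p → ℝ}
    (hu : u ∈ Submodule.span ℝ (evalUnit hp x '' Set.Icc 1 ((n + 1) * p)))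
    (h : momentMap n x (massMap A u) = 0) : massMap A u = 0 := by
  have hpair : ∀ v ∈ Submodule.span ℝ (evalUnit hp x '' Set.Icc 1 ((n + 1) * p)),
      ∑ a, v a ⬝ᵥ (A a *ᵥ u a) = 0 := by
    intro v hv
    induction hv using Submodule.span_induction with
    | mem v hv =>
      obtain ⟨k, hk, rfl⟩ := hv
      have := congrFun h (⟨(k - 1) / p, index_div_lt hp hk⟩, ⟨(k - 1) % p, Nat.mod_lt _ hp⟩)
      simpa [evalUnit] using this
    | zero => simp
    | add v w _ _ hv hw => simp [add_dotProduct, Finset.sum_add_distrib, hv, hw]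
    | smul c v _ hv => simp [smul_dotProduct, ← Finset.mul_sum, hv]
  have hzero := (Finset.sum_eq_zero_iff_of_nonneg fun a _ => by
    simpa using (hpsd a).dotProduct_mulVec_nonneg (u a)).1 (hpair u hu)
  funext a
  exact ((hpsd a).dotProduct_mulVec_zero_iff (u a)).1 (by simpa using hzero a (mem_univ a))

/-- A linear dependence of a column of the moment matrix on the preceding ones propagates to the
column one block further to the right. -/
lemma colMM_add_mem_span {n : ℕ} (hp : 0 < p) {S : ℕ → Matrix (Fin p) (Fin p) ℝ}
    {x : Fin ℓ → ℝ} {A : Fin ℓ → Matrix (Fin p) (Fin p) ℝ} (hpsd : ∀ j, (A j).PosSemidef)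
    (hmom : ∀ i, i ≤ 2 * n → S i = ∑ j, x j ^ i • A j)
    {k : ℕ} (hk : 1 ≤ k) (hkn : k ≤ n * p)
    (h : colMM n p hp S k ∈ Submodule.span ℝ (colMM n p hp S '' Set.Icc 1 (k - 1))) :
    colMM n p hp S (k + p) ∈
      Submodule.span ℝ (colMM n p hp S '' Set.Icc 1 (k + p - 1)) := by
  have hsucc : (n + 1) * p = n * p + p := by ring
  have himage : ∀ m ≤ (n + 1) * p, Submodule.span ℝ (colMM n p hp S '' Set.Icc 1 m) =
      ((Submodule.span ℝ (evalUnit hp x '' Set.Icc 1 m)).map (massMap A)).map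
        (momentMap n x) := by
    intro m hm
    rw [Submodule.map_span, Submodule.map_span, Set.image_image, Set.image_image]
    congr 1
    exact Set.image_congr fun r hr => colMM_eq_momentMap hp hmom ⟨hr.1, hr.2.trans hm⟩
  rw [himage _ (by omega), colMM_eq_momentMap hp hmom ⟨hk, by omega⟩] at h
  obtain ⟨_, ⟨u, hu, rfl⟩, huk⟩ := h
  have heq : massMap A u = massMap A (evalUnit hp x k) := by
    rw [← sub_eq_zero, ← map_sub]
    refine massMap_eq_zero_of_momentMap_eq_zero (n := n) (x := x) hp hpsd
      (Submodule.sub_mem _ ?_ ?_) ?_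
    · exact Submodule.span_mono (Set.image_mono (Set.Icc_subset_Icc_right (by omega))) hu
    · exact Submodule.subset_span ⟨k, ⟨hk, by omega⟩, rfl⟩
    · rw [map_sub, map_sub, huk, sub_self]
  rw [himage _ (by omega), colMM_eq_momentMap hp hmom ⟨by omega, by omega⟩]
  refine Submodule.mem_map_of_mem ?_
  rw [← shiftMap_massMap_evalUnit hp x A hk, ← heq]
  have hshift : (Submodule.span ℝ (evalUnit hp x '' Set.Icc 1 (k - 1))).map
      (shiftMap x ∘ₗ massMap A) ≤
        (Submodule.span ℝ (evalUnit hp x '' Set.Icc 1 (k + p - 1))).map (massMap A) := by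
    rw [Submodule.map_span_le]
    rintro _ ⟨r, ⟨hr, hrk⟩, rfl⟩
    rw [LinearMap.comp_apply, shiftMap_massMap_evalUnit hp x A hr]
    exact Submodule.mem_map_of_mem (Submodule.subset_span ⟨r + p, ⟨by omega, by omega⟩, rfl⟩)
  exact hshift ⟨u, hu, rfl⟩

lemma depSet_subset_Icc (n p : ℕ) (hp : 0 < p) (S : ℕ → Matrix (Fin p) (Fin p) ℝ) (i : ℕ) :
    depSet n p hp S i ⊆ Set.Icc 1 p := fun _ hj => hj.1

lemma depSet_subset_succ {n : ℕ} (hp : 0 < p) {S : ℕ → Matrix (Fin p) (Fin p) ℝ}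
    {x : Fin ℓ → ℝ} {A : Fin ℓ → Matrix (Fin p) (Fin p) ℝ} (hpsd : ∀ j, (A j).PosSemidef)
    (hmom : ∀ i, i ≤ 2 * n → S i = ∑ j, x j ^ i • A j) {i : ℕ} (hi : i < n) :
    depSet n p hp S i ⊆ depSet n p hp S (i + 1) := by
  rintro j ⟨hj, h⟩
  have hin : (i + 1) * p ≤ n * p := Nat.mul_le_mul_right p hi
  have hsucc : (i + 1) * p = i * p + p := by ring
  have h1 := hj.1
  have h2 := hj.2
  refine ⟨hj, ?_⟩
  rw [show (i + 1) * p + j = i * p + j + p by omega]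
  exact colMM_add_mem_span hp hpsd hmom (by omega) (by omega) h

end MomentMatrix

/-- **Corollary 2.4**: if `S_0, …, S_{2n}` admits a representing measure, then
`Card Dep(X^i) ≤ Card Dep(X^{i+1}) ≤ p` for all `i ∈ {0,…,n-1}`. -/
theorem depSet_card_mono (n p : ℕ) (hn : 1 ≤ n) (hp : 0 < p)
    (S : ℕ → Matrix (Fin p) (Fin p) ℝ)
    (ℓ : ℕ) (x : Fin ℓ → ℝ) (A : Fin ℓ → Matrix (Fin p) (Fin p) ℝ)
    (hx : Function.Injective x) (hpsd : ∀ j, (A j).PosSemidef) (hA0 : ∀ j, A j ≠ 0)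
    (hmom : ∀ i, i ≤ 2 * n → S i = ∑ j, x j ^ i • A j) :
    ∀ i, i < n →
      (depSet n p hp S i).ncard ≤ (depSet n p hp S (i + 1)).ncard ∧
        (depSet n p hp S (i + 1)).ncard ≤ p := by
  intro i hi
  have hsub := MomentMatrix.depSet_subset_Icc n p hp S (i + 1)
  refine ⟨Set.ncard_le_ncard (MomentMatrix.depSet_subset_succ hp hpsd hmom hi)
    ((Set.finite_Icc 1 p).subset hsub), ?_⟩
  calc (depSet n p hp S (i + 1)).ncard ≤ (Set.Icc 1 p).ncard :=
        Set.ncard_le_ncard hsub (Set.finite_Icc 1 p)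
    _ = p := by simp [Set.ncard_eq_toFinset_card']
end

section
/- Let p, n ≥ 1, t ∈ ℝ, and let H(x) = Σ_{i=0}^{n} (x−t)^i H_i with H_i ∈ M_p(ℝ) be a nonzero matrix polynomial. For k ∈ {0,…,n} set W_k := ∩_{i=0}^{k} Ker H_i and s_k := dim W_k. Then: (a) if s_n > 0, then det H(x) is the zero polynomial; (b) the polynomial (x−t)^{s_0 + s_1 + ⋯ + s_{n−1}} divides det H(x); (c) if moreover H_n is invertible, then det H(x) is a nonzero polynomial of degree np, so det H(x) = (x−t)^{Σ_{k=0}^{n−1} s_k} · g(x) for some nonzero polynomial g(x). -/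
open Finset Matrix Polynomial

/-- The matrix polynomial `H(x) = ∑_{i=0}^{n} (x - t)^i H_i` as a `p × p` matrix over
`ℝ[X]`. -/
noncomputable def matPolyShift (n p : ℕ) (t : ℝ) (H : ℕ → Matrix (Fin p) (Fin p) ℝ) :
    Matrix (Fin p) (Fin p) (Polynomial ℝ) :=
  fun a b => ∑ i ∈ Finset.range (n + 1),
    Polynomial.C (H i a b) * (Polynomial.X - Polynomial.C t) ^ i

/-- `s_k = dim (∩_{i=0}^{k} Ker H_i)`. -/
noncomputable def sdim (p : ℕ) (H : ℕ → Matrix (Fin p) (Fin p) ℝ) (k : ℕ) : ℕ :=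
  Module.finrank ℝ
    ↥(⨅ i ∈ Finset.range (k + 1), LinearMap.ker (H i).mulVecLin)

/-- A subspace of `ℝ^p` is the column space of a matrix with a left inverse. -/
theorem exists_matrix_leftInverse_of_submodule {p : ℕ} (W : Submodule ℝ (Fin p → ℝ)) :
    ∃ (A : Matrix (Fin p) (Fin (Module.finrank ℝ W)) ℝ)
      (B : Matrix (Fin (Module.finrank ℝ W)) (Fin p) ℝ),
      B * A = 1 ∧ (∀ u, A *ᵥ u ∈ W) ∧ ∀ v ∈ W, (A * B) *ᵥ v = v := by
  let e := (Module.finBasis ℝ W).equivFun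
  let f : (Fin (Module.finrank ℝ W) → ℝ) →ₗ[ℝ] (Fin p → ℝ) := W.subtype ∘ₗ e.symm.toLinearMap
  have hf : LinearMap.ker f = ⊥ :=
    LinearMap.ker_eq_bot.2 (Subtype.val_injective.comp e.symm.injective)
  obtain ⟨g, hg⟩ := f.exists_leftInverse_of_injective hf
  refine ⟨LinearMap.toMatrix' f, LinearMap.toMatrix' g, ?_, fun u => ?_, fun v hv => ?_⟩
  · rw [← LinearMap.toMatrix'_comp, hg, LinearMap.toMatrix'_id]
  · rw [LinearMap.toMatrix'_mulVec]
    exact (e.symm u).2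
  · rw [← LinearMap.toMatrix'_comp, LinearMap.toMatrix'_mulVec]
    have hfv : f (e ⟨v, hv⟩) = v := by simp [f]
    have hgv : g (f (e ⟨v, hv⟩)) = e ⟨v, hv⟩ := LinearMap.congr_fun hg _
    rw [hfv] at hgv
    rw [LinearMap.comp_apply, hgv, hfv]

theorem mem_iInf_ker_mulVecLin {p : ℕ} {H : ℕ → Matrix (Fin p) (Fin p) ℝ} {k : ℕ}
    {v : Fin p → ℝ} :
    v ∈ (⨅ i ∈ Finset.range (k + 1), LinearMap.ker (H i).mulVecLin) ↔
      ∀ i ≤ k, H i *ᵥ v = 0 := by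
  simp [Submodule.mem_iInf]

/-- If `M = ∑_{i<n} y^i H_i + y^n Q`, then `y^{s_0 + ⋯ + s_{n-1}}` divides `det M`. -/
theorem pow_sum_sdim_dvd_det {R : Type*} [CommRing R] [Algebra ℝ R] {p : ℕ} (y : R) (n : ℕ)
    (H : ℕ → Matrix (Fin p) (Fin p) ℝ) (Q : Matrix (Fin p) (Fin p) R) :
    y ^ (∑ k ∈ Finset.range n, sdim p H k) ∣
      (∑ i ∈ Finset.range n, y ^ i • (H i).map (algebraMap ℝ R) + y ^ n • Q).det := by
  induction n generalizing H Q with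
  | zero => simp
  | succ n ih =>
    obtain ⟨A, B, hBA, hA, hAB⟩ := exists_matrix_leftInverse_of_submodule
      (⨅ i ∈ Finset.range (0 + 1), LinearMap.ker (H i).mulVecLin)
    have hHA : H 0 * A = 0 := by
      refine Matrix.ext_of_mulVec_single fun j => ?_
      rw [← Matrix.mulVec_mulVec, mem_iInf_ker_mulVecLin.1 (hA _) 0 le_rfl, Matrix.zero_mulVec]
    let φ := algebraMap ℝ R
    let E : Matrix (Fin p) (Fin p) R := (A * B).map φ
    have hEE : E * E = E := by
      simp only [E, ← Matrix.map_mul]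
      rw [Matrix.mul_assoc, ← Matrix.mul_assoc B, hBA, Matrix.one_mul]
    have hHE : (H 0).map φ * E = 0 := by
      simp only [E, ← Matrix.map_mul]
      rw [← Matrix.mul_assoc, hHA, Matrix.zero_mul, Matrix.map_zero _ (map_zero φ)]
    let H' : ℕ → Matrix (Fin p) (Fin p) ℝ := fun i => H i * (1 - A * B) + H (i + 1) * (A * B)
    have hH' (i : ℕ) : (H' i).map φ = (H i).map φ * (1 - E) + (H (i + 1)).map φ * E := by
      simp only [H', E, Matrix.map_add _ (map_add φ), Matrix.map_mul, Matrix.map_sub _ (map_sub φ),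
        Matrix.map_one _ (map_zero φ) (map_one φ)]
    let Q' : Matrix (Fin p) (Fin p) R := ((H n).map φ + y • Q) * (1 - E) + Q * E
    have hD : (1 + (y - 1) • E).det = y ^ sdim p H 0 := by
      have h : (1 + (y - 1) • E) = 1 + ((y - 1) • A.map φ) * B.map φ := by
        rw [Matrix.smul_mul, ← Matrix.map_mul]
      rw [h, Matrix.det_one_add_mul_comm, Matrix.mul_smul, ← Matrix.map_mul, hBA,
        Matrix.map_one _ (map_zero φ) (map_one φ), ← one_smul R (1 : Matrix _ _ R), smul_smul,
        ← add_smul, mul_one, add_sub_cancel, Matrix.det_smul, Matrix.det_one, mul_one,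
        Fintype.card_fin, sdim]
    have hfac : ∑ i ∈ Finset.range (n + 1), y ^ i • (H i).map φ + y ^ (n + 1) • Q =
        (∑ i ∈ Finset.range n, y ^ i • (H' i).map φ + y ^ n • Q') * (1 + (y - 1) • E) := by
      have h1 : (1 - E) * (1 + (y - 1) • E) = 1 - E := by
        rw [Matrix.mul_add, Matrix.mul_smul, Matrix.sub_mul, Matrix.sub_mul, hEE]
        simp
      have h2 : E * (1 + (y - 1) • E) = y • E := by
        rw [Matrix.mul_add, Matrix.mul_smul, hEE, Matrix.mul_one, sub_smul, one_smul]
        abel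
      set M := ∑ i ∈ Finset.range (n + 1), y ^ i • (H i).map φ + y ^ (n + 1) • Q with hM
      set N := ∑ i ∈ Finset.range n, y ^ i • (H (i + 1)).map φ + y ^ n • Q with hN
      have hME : M * E = y • (N * E) := by
        rw [hM, hN, Finset.sum_range_succ', Matrix.add_mul, Matrix.add_mul, Matrix.smul_mul, hHE]
        simp only [Matrix.add_mul, smul_add, Finset.smul_sum, Finset.sum_mul, smul_smul,
          Matrix.smul_mul, pow_succ', smul_zero, add_zero]
      have hM' : ∑ i ∈ Finset.range n, y ^ i • (H' i).map φ + y ^ n • Q' =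
          M * (1 - E) + N * E := by
        rw [hM, hN, Finset.sum_range_succ]
        simp only [hH', Q', Matrix.add_mul, smul_add, Finset.sum_add_distrib, Finset.sum_mul,
          Matrix.smul_mul, smul_smul, pow_succ]
        abel
      rw [hM', Matrix.add_mul, Matrix.mul_assoc, Matrix.mul_assoc, h1, h2, Matrix.mul_smul, ← hME,
        ← Matrix.mul_add, sub_add_cancel, Matrix.mul_one]
    rw [hfac, Matrix.det_mul, hD, Finset.sum_range_succ', pow_add]
    refine mul_dvd_mul_right ((pow_dvd_pow y (Finset.sum_le_sum fun k _ => ?_)).trans (ih H' Q')) _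
    refine Submodule.finrank_mono fun v hv => ?_
    rw [mem_iInf_ker_mulVecLin] at hv ⊢
    intro i hi
    have hv0 : (A * B) *ᵥ v = v :=
      hAB v (mem_iInf_ker_mulVecLin.2 fun j hj => hv j (by omega))
    simp only [H', Matrix.add_mulVec, ← Matrix.mulVec_mulVec, Matrix.sub_mulVec,
      Matrix.one_mulVec]
    rw [Matrix.mulVec_mulVec _ A B, hv0, hv (i + 1) (by omega)]
    simp

/-- The coefficient of degree `n * p` of the determinant of a `p × p` matrix of polynomials of
degree at most `n` is the determinant of the matrix of coefficients of degree `n`. -/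
theorem coeff_det_of_natDegree_le {R : Type*} [CommRing R] {p n : ℕ}
    {M : Matrix (Fin p) (Fin p) R[X]} (hM : ∀ a b, (M a b).natDegree ≤ n) :
    M.det.coeff (n * p) = (M.map fun f => f.coeff n).det := by
  simp only [Matrix.det_apply, Polynomial.finsetSum_coeff, Polynomial.coeff_smul, Matrix.map_apply]
  refine Finset.sum_congr rfl fun σ _ => ?_
  have h := Polynomial.coeff_prod_of_natDegree_le (s := Finset.univ) (fun i => M (σ i) i) n
    fun i _ => hM _ _
  rw [Finset.card_univ, Fintype.card_fin, mul_comm] at h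
  rw [h]

theorem natDegree_det_le_of_natDegree_le {R : Type*} [CommRing R] {p n : ℕ}
    {M : Matrix (Fin p) (Fin p) R[X]} (hM : ∀ a b, (M a b).natDegree ≤ n) :
    M.det.natDegree ≤ n * p := by
  rw [Matrix.det_apply]
  refine Polynomial.natDegree_sum_le_of_forall_le _ _ fun σ _ => ?_
  refine (Polynomial.natDegree_smul_le _ _).trans ((Polynomial.natDegree_prod_le _ _).trans ?_)
  refine (Finset.sum_le_card_nsmul _ _ n fun i _ => hM _ _).trans ?_
  simp [mul_comm]

theorem matPolyShift_eq_sum_smul (n p : ℕ) (t : ℝ) (H : ℕ → Matrix (Fin p) (Fin p) ℝ) :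
    matPolyShift n p t H =
      ∑ i ∈ Finset.range (n + 1), (X - C t) ^ i • (H i).map (algebraMap ℝ ℝ[X]) := by
  ext1 a b
  simp [matPolyShift, Matrix.sum_apply, mul_comm]

theorem natDegree_matPolyShift_le (n p : ℕ) (t : ℝ) (H : ℕ → Matrix (Fin p) (Fin p) ℝ)
    (a b : Fin p) : (matPolyShift n p t H a b).natDegree ≤ n := by
  refine Polynomial.natDegree_sum_le_of_forall_le _ _ fun i hi => ?_
  refine (Polynomial.natDegree_C_mul_le _ _).trans ?_
  rw [Polynomial.natDegree_pow, Polynomial.natDegree_X_sub_C]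
  have := Finset.mem_range.1 hi
  omega

theorem coeff_matPolyShift (n p : ℕ) (t : ℝ) (H : ℕ → Matrix (Fin p) (Fin p) ℝ)
    (a b : Fin p) : (matPolyShift n p t H a b).coeff n = H n a b := by
  have hdeg (i : ℕ) : ((X - C t) ^ i).natDegree = i := by
    rw [Polynomial.natDegree_pow, Polynomial.natDegree_X_sub_C, mul_one]
  have htop : ((X - C t) ^ n).coeff n = 1 := by
    simpa [hdeg] using ((Polynomial.monic_X_sub_C t).pow n).coeff_natDegree
  simp only [matPolyShift, Polynomial.finsetSum_coeff, Polynomial.coeff_C_mul]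
  rw [Finset.sum_range_succ, htop, mul_one, Finset.sum_eq_zero, zero_add]
  intro i hi
  rw [Polynomial.coeff_eq_zero_of_natDegree_lt ((hdeg i).trans_lt (Finset.mem_range.1 hi)),
    mul_zero]

theorem det_matPolyShift_eq_zero {n p : ℕ} (t : ℝ) {H : ℕ → Matrix (Fin p) (Fin p) ℝ}
    (hs : 0 < sdim p H n) : (matPolyShift n p t H).det = 0 := by
  have : Nontrivial ↥(⨅ i ∈ Finset.range (n + 1), LinearMap.ker (H i).mulVecLin) :=
    Module.finrank_pos_iff.1 hs
  obtain ⟨⟨v, hv⟩, hv0⟩ :=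
    exists_ne (0 : ↥(⨅ i ∈ Finset.range (n + 1), LinearMap.ker (H i).mulVecLin))
  rw [mem_iInf_ker_mulVecLin] at hv
  refine Matrix.exists_mulVec_eq_zero_iff.1 ⟨algebraMap ℝ ℝ[X] ∘ v, fun h => hv0 ?_, ?_⟩
  · ext j
    simpa using congrFun h j
  · rw [matPolyShift_eq_sum_smul, Matrix.sum_mulVec]
    refine Finset.sum_eq_zero fun i hi => ?_
    have h : (H i).map (algebraMap ℝ ℝ[X]) *ᵥ (algebraMap ℝ ℝ[X] ∘ v) = 0 := by
      ext1 j
      rw [← RingHom.map_mulVec, hv i (Nat.lt_succ_iff.1 (Finset.mem_range.1 hi))]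
      simp
    rw [Matrix.smul_mulVec, h, smul_zero]

/-- **Lemma 2.9**: factorization of the determinant of
`H(x) = ∑ (x-t)^i H_i`. (a) If `s_n > 0` then `det H = 0`; (b) `(x-t)^{s_0+⋯+s_{n-1}}`
divides `det H(x)`; (c) if `H_n` is invertible then `det H` is nonzero of degree `np`,
so `det H(x) = (x-t)^{∑ s_k} g(x)` with `g ≠ 0`. -/
theorem det_matrix_polynomial_factorization (p n : ℕ) (hp : 0 < p) (hn : 1 ≤ n)
    (t : ℝ) (H : ℕ → Matrix (Fin p) (Fin p) ℝ)
    (hH : ∃ i, i ≤ n ∧ H i ≠ 0) :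
    (0 < sdim p H n → (matPolyShift n p t H).det = 0) ∧
    ((Polynomial.X - Polynomial.C t) ^ (∑ k ∈ Finset.range n, sdim p H k) ∣
      (matPolyShift n p t H).det) ∧
    (IsUnit (H n) →
      (matPolyShift n p t H).det ≠ 0 ∧
      (matPolyShift n p t H).det.natDegree = n * p ∧
      ∃ g : Polynomial ℝ, g ≠ 0 ∧
        (matPolyShift n p t H).det =
          (Polynomial.X - Polynomial.C t) ^ (∑ k ∈ Finset.range n, sdim p H k) * g) := by
  have hdvd : (X - C t) ^ (∑ k ∈ Finset.range n, sdim p H k) ∣ (matPolyShift n p t H).det := by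
    rw [matPolyShift_eq_sum_smul, Finset.sum_range_succ]
    exact pow_sum_sdim_dvd_det _ n H _
  refine ⟨det_matPolyShift_eq_zero t, hdvd, fun hu => ?_⟩
  have hcoeff : (matPolyShift n p t H).det.coeff (n * p) ≠ 0 := by
    have hmap : ((matPolyShift n p t H).map fun f => f.coeff n) = H n :=
      Matrix.ext fun a b => coeff_matPolyShift n p t H a b
    rw [coeff_det_of_natDegree_le (natDegree_matPolyShift_le n p t H), hmap]
    exact ((Matrix.isUnit_iff_isUnit_det _).1 hu).ne_zero
  have hne : (matPolyShift n p t H).det ≠ 0 := fun h => hcoeff (by rw [h, coeff_zero])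
  refine ⟨hne, le_antisymm
    (natDegree_det_le_of_natDegree_le (natDegree_matPolyShift_le n p t H))
    (le_natDegree_of_ne_zero hcoeff), ?_⟩
  obtain ⟨g, hg⟩ := hdvd
  exact ⟨g, fun h => hne (by rw [hg, h, mul_zero]), hg⟩
end

section
/- Let n ≥ 1, p ≥ 1, t ∈ ℝ, let 𝒮 = (S_0,…,S_{2n}) in 𝕊_p(ℝ), and T_i := Σ_{ℓ=0}^{i} binom(i,ℓ)(−1)^ℓ t^ℓ S_{i−ℓ}. Let J' be the n×n matrix (rows and columns indexed 0,…,n−1) with J'_{k,i} = binom(i,k)(−t)^{i−k} for k ≤ i and 0 otherwise. Then (T_{i+j−1})_{i,j=1}^{n} = (J' ⊗ I_p)ᵀ (S_{i+j−1} − t·S_{i+j−2})_{i,j=1}^{n} (J' ⊗ I_p); in particular, rank (T_{i+j−2})_{1≤i≤n, 2≤j≤n+1} = rank (S_{i+j−1} − t·S_{i+j−2})_{i,j=1}^{n}. -/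
open Finset Matrix

/-- The shifted moments `T_i = ∑_{ℓ=0}^{i} C(i,ℓ)(-1)^ℓ t^ℓ S_{i-ℓ}`. -/
def shiftT (p : ℕ) (t : ℝ) (S : ℕ → Matrix (Fin p) (Fin p) ℝ) (i : ℕ) :
    Matrix (Fin p) (Fin p) ℝ :=
  ∑ l ∈ Finset.range (i + 1), ((i.choose l : ℝ) * (-1) ^ l * t ^ l) • S (i - l)

/-- The `n × n` change-of-basis matrix `J'` with `J'_{k,i} = C(i,k)(-t)^{i-k}`
for `k ≤ i`. -/
def Jmat' (n : ℕ) (t : ℝ) : Matrix (Fin n) (Fin n) ℝ :=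
  fun k i => if k.1 ≤ i.1 then (i.1.choose k.1 : ℝ) * (-t) ^ (i.1 - k.1) else 0

/-- The localizing matrix `(T_{i+j-1})_{i,j=1}^{n}` of the shifted sequence
(0-based block entry `T_{i+j+1}`). -/
def locT (n p : ℕ) (t : ℝ) (S : ℕ → Matrix (Fin p) (Fin p) ℝ) :
    Matrix (Fin n × Fin p) (Fin n × Fin p) ℝ :=
  fun ia jb => shiftT p t S (ia.1.1 + jb.1.1 + 1) ia.2 jb.2

/-- The localizing matrix `(S_{i+j-1} - t·S_{i+j-2})_{i,j=1}^{n}` (0-based block entry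
`S_{i+j+1} - t·S_{i+j}`). -/
def locS (n p : ℕ) (t : ℝ) (S : ℕ → Matrix (Fin p) (Fin p) ℝ) :
    Matrix (Fin n × Fin p) (Fin n × Fin p) ℝ :=
  fun ia jb => S (ia.1.1 + jb.1.1 + 1) ia.2 jb.2 - t * S (ia.1.1 + jb.1.1) ia.2 jb.2

/-- The moment functional `ℝ[X] → M` sending `X ^ k` to `S k`. -/
noncomputable def momentFunctional {M : Type*} [AddCommGroup M] [Module ℝ M] (S : ℕ → M) :
    Polynomial ℝ →ₗ[ℝ] M :=
  (Polynomial.basisMonomials ℝ).constr ℝ S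

theorem momentFunctional_X_pow {M : Type*} [AddCommGroup M] [Module ℝ M] (S : ℕ → M) (k : ℕ) :
    momentFunctional S (Polynomial.X ^ k) = S k := by
  have h := (Polynomial.basisMonomials ℝ).constr_basis ℝ S k
  simpa only [momentFunctional, Polynomial.coe_basisMonomials,
    Polynomial.monomial_one_right_eq_X_pow] using h

theorem shiftT_eq_momentFunctional (p : ℕ) (t : ℝ) (S : ℕ → Matrix (Fin p) (Fin p) ℝ) (i : ℕ) :
    shiftT p t S i = momentFunctional S ((Polynomial.X - Polynomial.C t) ^ i) := by
  have h : (Polynomial.X - Polynomial.C t) ^ i =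
      ∑ l ∈ range (i + 1),
        ((i.choose l : ℝ) * (-1) ^ l * t ^ l) • (Polynomial.X : Polynomial ℝ) ^ (i - l) := by
    rw [sub_eq_neg_add, add_pow]
    refine sum_congr rfl fun l _ => ?_
    rw [Polynomial.smul_eq_C_mul, neg_pow]
    simp only [map_mul, map_pow, map_neg, map_one, map_natCast]
    ring
  simp only [shiftT, h, map_sum, map_smul, momentFunctional_X_pow]

theorem Jmat'_apply (n : ℕ) (t : ℝ) (k i : Fin n) :
    Jmat' n t k i = ((Polynomial.X - Polynomial.C t) ^ i.1).coeff k.1 := by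
  rw [sub_eq_add_neg, ← Polynomial.C_neg, Polynomial.coeff_X_add_C_pow, Jmat']
  split_ifs with h
  · ring
  · simp [Nat.choose_eq_zero_of_lt (not_le.mp h)]

theorem X_sub_C_pow_eq_sum_Jmat' (n : ℕ) (t : ℝ) (i : Fin n) :
    (Polynomial.X - Polynomial.C t) ^ i.1 =
      ∑ k : Fin n, Jmat' n t k i • (Polynomial.X : Polynomial ℝ) ^ k.1 := by
  have hdeg : ((Polynomial.X - Polynomial.C t) ^ i.1).natDegree < n := by
    rw [Polynomial.natDegree_pow, Polynomial.natDegree_X_sub_C, mul_one]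
    exact i.2
  conv_lhs => rw [Polynomial.as_sum_range' _ n hdeg]
  rw [sum_range]
  refine sum_congr rfl fun k _ => ?_
  rw [Jmat'_apply, Polynomial.smul_X_eq_monomial]

theorem det_Jmat' (n : ℕ) (t : ℝ) : (Jmat' n t).det = 1 := by
  have h : (Jmat' n t).IsUpperTriangular := fun i j hij => if_neg (not_le.mpr hij)
  rw [Matrix.det_of_isUpperTriangular h]
  simp [Jmat']

theorem shiftT_add_add_one (n p : ℕ) (t : ℝ) (S : ℕ → Matrix (Fin p) (Fin p) ℝ) (i j : Fin n) :
    shiftT p t S (i.1 + j.1 + 1) =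
      ∑ l, ∑ k, (Jmat' n t k i * Jmat' n t l j) • (S (k.1 + l.1 + 1) - t • S (k.1 + l.1)) := by
  have h : (Polynomial.X - Polynomial.C t) ^ (i.1 + j.1 + 1) =
      ∑ l, ∑ k, (Jmat' n t k i * Jmat' n t l j) •
        ((Polynomial.X : Polynomial ℝ) ^ (k.1 + l.1 + 1) -
          t • (Polynomial.X : Polynomial ℝ) ^ (k.1 + l.1)) := by
    rw [pow_succ, pow_add, X_sub_C_pow_eq_sum_Jmat' n t i, X_sub_C_pow_eq_sum_Jmat' n t j,
      sum_mul_sum, sum_comm, sum_mul]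
    refine sum_congr rfl fun l _ => ?_
    rw [sum_mul]
    refine sum_congr rfl fun k _ => ?_
    simp only [Polynomial.smul_eq_C_mul, map_mul]
    ring
  rw [shiftT_eq_momentFunctional, h]
  simp only [map_sum, map_smul, map_sub, momentFunctional_X_pow]

theorem locT_eq_congr (n p : ℕ) (t : ℝ) (S : ℕ → Matrix (Fin p) (Fin p) ℝ) :
    locT n p t S =
      (Matrix.kroneckerMap (· * ·) (Jmat' n t) (1 : Matrix (Fin p) (Fin p) ℝ))ᵀ *
        locS n p t S *
        Matrix.kroneckerMap (· * ·) (Jmat' n t) (1 : Matrix (Fin p) (Fin p) ℝ) := by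
  ext ⟨i, a⟩ ⟨j, b⟩
  simp only [locT, shiftT_add_add_one, Matrix.mul_apply, Fintype.sum_prod_type,
    Matrix.transpose_apply, Matrix.kroneckerMap_apply, Matrix.one_apply, locS,
    Matrix.sum_apply, Matrix.smul_apply, Matrix.sub_apply, smul_eq_mul, mul_ite, ite_mul,
    mul_one, mul_zero, zero_mul, sum_ite_eq', mem_univ, if_true, sum_mul]
  refine sum_congr rfl fun l _ => sum_congr rfl fun k _ => ?_
  ring

/-- The localizing matrices of `𝒯` and of `𝒮` are congruent via `J' ⊗ I_p`; in
particular they have equal rank. -/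
theorem localizing_matrix_translation (n p : ℕ) (hn : 1 ≤ n) (hp : 0 < p)
    (t : ℝ) (S : ℕ → Matrix (Fin p) (Fin p) ℝ) :
    locT n p t S =
        (Matrix.kroneckerMap (· * ·) (Jmat' n t) (1 : Matrix (Fin p) (Fin p) ℝ))ᵀ *
          locS n p t S *
          Matrix.kroneckerMap (· * ·) (Jmat' n t) (1 : Matrix (Fin p) (Fin p) ℝ) ∧
      (locT n p t S).rank = (locS n p t S).rank := by
  have hdet : IsUnit
      (Matrix.kroneckerMap (· * ·) (Jmat' n t) (1 : Matrix (Fin p) (Fin p) ℝ)).det := by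
    rw [Matrix.det_kronecker, det_Jmat', Matrix.det_one, one_pow, one_pow, one_mul]
    exact isUnit_one
  refine ⟨locT_eq_congr n p t S, ?_⟩
  rw [locT_eq_congr, Matrix.rank_mul_eq_left_of_isUnit_det _ _ hdet,
    Matrix.rank_mul_eq_right_of_isUnit_det _ _ (by rwa [Matrix.det_transpose])]
end
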